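/- arXiv:1712.02606 — 2 statements merged into one kernel-verified Lean document; each statement's English description precedes it below -/
import Mathlib

section
/- Let a, b > 1 with log_b a = p/q where p, q are coprime positive integers, and set β = b^p = a^q. Then the intervals a^r·b^s·[1, a^{1/p}) for (r,s) ∈ {0,...,q−1} × {0,...,p−1} are pairwise β^ℤ-dilation disjoint: a^{r₁}b^{s₁}[1,a^{1/p}) ∩ βᵏ·a^{r₂}b^{s₂}[1,a^{1/p}) = ∅ whenever (r₁,s₁,k) ≠ (r₂,s₂,0). -/
open Set

theorem int_part (p q : ℕ) (hp : 0 < p) (hq : 0 < q) (hco : Nat.Coprime p q)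
    (r₁ r₂ s₁ s₂ : ℕ) (hr₁ : r₁ < q) (hr₂ : r₂ < q) (hs₁ : s₁ < p) (hs₂ : s₂ < p)
    (k : ℤ) (h : (p * r₁ + q * s₁ : ℤ) = p * q * k + p * r₂ + q * s₂) :
    r₁ = r₂ ∧ s₁ = s₂ ∧ k = 0 := by
  have hc : IsCoprime (q : ℤ) (p : ℤ) := (Nat.isCoprime_iff_coprime.mpr hco).symm
  have h1 : (q : ℤ) ∣ (r₁ : ℤ) - r₂ := by
    apply hc.dvd_of_dvd_mul_left
    exact ⟨p * k + s₂ - s₁, by linarith⟩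
  have h2 : (r₁ : ℤ) - r₂ = 0 :=
    Int.eq_zero_of_abs_lt_dvd h1 (by rw [abs_lt]; omega)
  have hq' : (q : ℤ) ≠ 0 := by omega
  have h3 : (s₁ : ℤ) - s₂ = p * k := by
    apply mul_left_cancel₀ hq'
    linear_combination h - (p : ℤ) * h2
  have h4 : (s₁ : ℤ) - s₂ = 0 :=
    Int.eq_zero_of_abs_lt_dvd ⟨k, h3⟩ (by rw [abs_lt]; omega)
  have h5 : k = 0 := by
    rw [h4] at h3
    rcases mul_eq_zero.mp h3.symm with h | h
    · omega
    · exact h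
  exact ⟨by omega, by omega, h5⟩

theorem stmt_5 (a b : ℝ) (ha : 1 < a) (hb : 1 < b) (p q : ℕ)
    (hp : 0 < p) (hq : 0 < q) (hco : Nat.Coprime p q)
    (hlog : Real.logb b a = (p : ℝ) / q)
    (β : ℝ) (hβ : β = b ^ p)
    (r₁ r₂ s₁ s₂ : ℕ) (hr₁ : r₁ < q) (hr₂ : r₂ < q) (hs₁ : s₁ < p) (hs₂ : s₂ < p)
    (k : ℤ) (hne : (r₁, s₁, k) ≠ (r₂, s₂, 0)) :
    ((fun x => a ^ r₁ * b ^ s₁ * x) '' Ico 1 (a ^ ((1 : ℝ) / p))) ∩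
      ((fun x => β ^ k * (a ^ r₂ * b ^ s₂ * x)) '' Ico 1 (a ^ ((1 : ℝ) / p))) = ∅ := by
  rw [Set.eq_empty_iff_forall_notMem]
  rintro _ ⟨⟨x, ⟨hx1, hx2⟩, rfl⟩, ⟨y, ⟨hy1, hy2⟩, hxy⟩⟩
  have ha0 : 0 < a := by linarith
  have hb0 : 0 < b := by linarith
  have hx0 : 0 < x := by linarith
  have hy0 : 0 < y := by linarith
  have hp' : (0 : ℝ) < p := by exact_mod_cast hp
  have hq' : (0 : ℝ) < q := by exact_mod_cast hq
  have hlb : 0 < Real.log b := Real.log_pos hb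
  obtain ⟨L, hL⟩ : ∃ L, L = Real.log b / q := ⟨_, rfl⟩
  have hL0 : 0 < L := by rw [hL]; positivity
  have hbL : Real.log b = q * L := by rw [hL]; field_simp
  have haL : Real.log a = p * L := by
    rw [Real.logb, div_eq_div_iff hlb.ne' hq'.ne', hbL] at hlog
    apply mul_right_cancel₀ hq'.ne'
    linarith
  have hc : Real.log (a ^ ((1 : ℝ) / p)) = L := by
    rw [Real.log_rpow ha0, haL]; field_simp
  have hlx := Real.log_lt_log hx0 hx2
  have hly := Real.log_lt_log hy0 hy2
  rw [hc] at hlx hly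
  have hlx0 := Real.log_nonneg hx1
  have hly0 := Real.log_nonneg hy1
  have hbp : 0 < b ^ p := by positivity
  have hbk : (b ^ p) ^ k ≠ 0 := (zpow_pos hbp k).ne'
  have key := congrArg Real.log hxy
  simp only [hβ] at key
  rw [Real.log_mul hbk (by positivity), Real.log_mul (by positivity) hy0.ne',
    Real.log_mul (by positivity) (by positivity), Real.log_mul (by positivity) hx0.ne',
    Real.log_mul (by positivity) (by positivity), Real.log_zpow] at key
  simp only [Real.log_pow, haL, hbL] at key
  obtain ⟨n, hn⟩ : ∃ n : ℤ, n = (p * q * k + p * r₂ + q * s₂) - (p * r₁ + q * s₁ : ℤ) :=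
    ⟨_, rfl⟩
  have hnL : (n : ℝ) * L = Real.log x - Real.log y := by
    rw [hn]; push_cast; linear_combination key
  have hn1 : n < 1 := by
    have : (n : ℝ) < 1 := by
      by_contra! h
      nlinarith
    exact_mod_cast this
  have hn2 : -1 < n := by
    have : (-1 : ℝ) < n := by
      by_contra! h
      nlinarith
    exact_mod_cast this
  have hn0 : n = 0 := by omega
  obtain ⟨h1, h2, h3⟩ := int_part p q hp hq hco r₁ r₂ s₁ s₂ hr₁ hr₂ hs₁ hs₂ k (by linarith)
  exact hne (by rw [h1, h2, h3])
end

section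
/- Every μ×ν complex matrix-valued measurable function A on a measurable set E ⊆ ℝ^d admits a measurable singular value decomposition: there exist measurable functions U: E → U(μ) (μ×μ unitaries), V: E → U(ν) (ν×ν unitaries), and a measurable diagonal min(μ,ν)×min(μ,ν) matrix-valued function Λ on E such that A(x) = U(x) · [[Λ(x), 0],[0, 0]] · V(x) for a.e. x ∈ E. -/
open Set MeasureTheory Matrix

lemma meas_exists_zero {X K : Type*} [MeasurableSpace X] [TopologicalSpace K]
    [SecondCountableTopology K]
    (F : X → K → ℝ) (hm : ∀ k, Measurable fun x => F x k) (hc : ∀ x, Continuous (F x))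
    (h0 : ∀ x k, 0 ≤ F x k) (C : Set K) (hC : IsCompact C) :
    MeasurableSet {x | ∃ k ∈ C, F x k = 0} := by
  obtain ⟨D, hDC, hD⟩ := TopologicalSpace.exists_countable_dense C
  have key : {x | ∃ k ∈ C, F x k = 0} =
      ⋂ n : ℕ, ⋃ k ∈ D, {x | F x (k : K) < 1 / ((n : ℝ) + 1)} := by
    ext x
    simp only [mem_ofPred_eq, mem_iInter, mem_iUnion, exists_prop]
    constructor
    · rintro ⟨k, hk, hz⟩ n
      have ho : IsOpen {c : C | F x (c : K) < 1 / ((n : ℝ) + 1)} :=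
        isOpen_lt ((hc x).comp continuous_subtype_val) continuous_const
      obtain ⟨y, hy, hyD⟩ := hD.exists_mem_open ho ⟨⟨k, hk⟩, by
        simp only [mem_ofPred_eq, hz]; positivity⟩
      exact ⟨y, hy, hyD⟩
    · intro h
      obtain ⟨y, hy, hyD⟩ := h 0
      obtain ⟨k, hk, hmin⟩ := hC.exists_isMinOn ⟨y, y.2⟩ (hc x).continuousOn
      refine ⟨k, hk, le_antisymm ?_ (h0 x k)⟩
      refine le_of_forall_pos_le_add fun ε hε => ?_
      obtain ⟨n, hn⟩ := exists_nat_one_div_lt hε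
      obtain ⟨z, hz, hzD⟩ := h n
      have := isMinOn_iff.1 hmin z z.2
      linarith
  rw [key]
  refine MeasurableSet.iInter fun n => MeasurableSet.biUnion hDC fun k _ => ?_
  exact measurableSet_lt (hm k) measurable_const

lemma exists_meas_selection {X K : Type*} [MeasurableSpace X] [TopologicalSpace K]
    [TopologicalSpace.MetrizableSpace K] [CompactSpace K] [Nonempty K]
    [MeasurableSpace K] [BorelSpace K]
    (F : X → K → ℝ) (hm : ∀ k, Measurable fun x => F x k) (hc : ∀ x, Continuous (F x))
    (h0 : ∀ x k, 0 ≤ F x k) (hex : ∀ x, ∃ k, F x k = 0) :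
    ∃ s : X → K, Measurable s ∧ ∀ x, F x (s x) = 0 := by
  let := TopologicalSpace.metrizableSpaceMetric K
  obtain ⟨f, hf, hfs⟩ := exists_nat_bool_continuous_surjective_of_compact K
  let φ : cantorSet → K := fun t => f (cantorSetHomeomorphNatToBool t)
  have hφ : Continuous φ := hf.comp cantorSetHomeomorphNatToBool.continuous
  have hφs : Function.Surjective φ := hfs.comp cantorSetHomeomorphNatToBool.surjective
  have : CompactSpace cantorSet := isCompact_iff_compactSpace.1 isCompact_cantorSet
  have hleast : ∀ x, ∃ t : cantorSet, F x (φ t) = 0 ∧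
      ∀ t' : cantorSet, F x (φ t') = 0 → (t : ℝ) ≤ t' := by
    intro x
    have hcl : IsClosed {t : cantorSet | F x (φ t) = 0} :=
      isClosed_eq ((hc x).comp hφ) continuous_const
    obtain ⟨k, hk⟩ := hex x
    obtain ⟨t, rfl⟩ := hφs k
    obtain ⟨m, hm, hmin⟩ := hcl.isCompact.exists_isMinOn ⟨t, hk⟩
      (continuous_subtype_val (p := (· ∈ cantorSet))).continuousOn
    exact ⟨m, hm, fun t' ht' => isMinOn_iff.1 hmin t' ht'⟩
  choose s hs hmin using hleast
  refine ⟨fun x => φ (s x), hφ.measurable.comp ?_, hs⟩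
  have hval : Measurable fun x => (s x : ℝ) := by
    refine measurable_of_Iic fun c => ?_
    have := meas_exists_zero (fun x t => F x (φ t)) (fun t => hm _) (fun x => (hc x).comp hφ)
      (fun x t => h0 _ _) {t : cantorSet | (t : ℝ) ≤ c}
      (isClosed_le continuous_subtype_val continuous_const).isCompact
    convert this using 1
    ext x
    simp only [mem_preimage, mem_Iic, mem_ofPred_eq]
    exact ⟨fun h => ⟨s x, h, hs x⟩, fun ⟨t, ht, hz⟩ => (hmin x t hz).trans ht⟩
  exact hval.subtype_mk

lemma exists_basis {μ ν : ℕ} (c : Fin ν → EuclideanSpace ℂ (Fin μ))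
    (hc : ∀ j k, j ≠ k → inner ℂ (c j) (c k) = 0) :
    ∃ (σ : Equiv.Perm (Fin ν)) (b : OrthonormalBasis (Fin μ) ℂ (EuclideanSpace ℂ (Fin μ))),
      ∀ (i : Fin μ) (j : Fin ν), (i : ℕ) ≠ (j : ℕ) → inner ℂ (b i) (c (σ j)) = 0 := by
  classical
  let r := Fintype.card {j // c j ≠ 0}
  have hrν : r ≤ ν := (Fintype.card_subtype_le (fun j => c j ≠ 0)).trans_eq (Fintype.card_fin ν)
  have hrμ : r ≤ μ := by
    have hli : LinearIndependent ℂ (fun j : {j // c j ≠ 0} => c j) :=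
      linearIndependent_of_ne_zero_of_inner_eq_zero (fun j => j.2)
        (fun j k hjk => hc _ _ (fun h => hjk (Subtype.ext h)))
    exact hli.fintype_card_le_finrank.trans_eq finrank_euclideanSpace_fin
  have e : {j : Fin ν // (j : ℕ) < r} ≃ {j // c j ≠ 0} := by
    refine Fintype.equivOfCardEq ?_
    rw [Fintype.card_congr (Fin.castLEquiv hrν).symm]
    simp [r]
  let σ : Equiv.Perm (Fin ν) := e.extendSubtype
  have hσ1 : ∀ j : Fin ν, (j : ℕ) < r → c (σ j) ≠ 0 := fun j hj => e.extendSubtype_mem j hj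
  have hσ2 : ∀ j : Fin ν, ¬ (j : ℕ) < r → c (σ j) = 0 := fun j hj =>
    not_not.1 (e.extendSubtype_not_mem j hj)
  let v : Fin μ → EuclideanSpace ℂ (Fin μ) := fun i =>
    if h : (i : ℕ) < ν then ((‖c (σ ⟨i, h⟩)‖⁻¹ : ℝ) : ℂ) • c (σ ⟨i, h⟩) else 0
  have hv : Orthonormal ℂ (Set.domRestrict {i : Fin μ | (i : ℕ) < r} v) := by
    constructor
    · rintro ⟨i, hi⟩
      have hi' : (i : ℕ) < r := hi
      have h : (i : ℕ) < ν := lt_of_lt_of_le hi' hrν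
      have := hσ1 ⟨i, h⟩ hi'
      simp [v, h, norm_smul, this]
    · rintro ⟨i, hi⟩ ⟨k, hk⟩ hik
      have h : (i : ℕ) < ν := lt_of_lt_of_le hi hrν
      have h' : (k : ℕ) < ν := lt_of_lt_of_le hk hrν
      have hne : σ ⟨i, h⟩ ≠ σ ⟨k, h'⟩ := by
        intro hh
        apply hik
        have := σ.injective hh
        simpa [Fin.ext_iff] using this
      simp [v, h, h', inner_smul_left, inner_smul_right, hc _ _ hne]
  obtain ⟨b, hb⟩ := hv.exists_orthonormalBasis_extension_of_card_eq (by simp)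
  refine ⟨σ, b, fun i j hij => ?_⟩
  by_cases hj : (j : ℕ) < r
  · have hjμ : (j : ℕ) < μ := lt_of_lt_of_le hj hrμ
    have hbj := hb ⟨j, hjμ⟩ hj
    have hcj : c (σ j) = ((‖c (σ j)‖ : ℝ) : ℂ) • b ⟨j, hjμ⟩ := by
      rw [hbj]
      have : ((‖c (σ j)‖ : ℝ) : ℂ) ≠ 0 := by simpa using hσ1 j hj
      simp only [v, Fin.is_lt, dif_pos, Fin.eta, smul_smul]
      rw [Complex.ofReal_inv, mul_inv_cancel₀ this, one_smul]
    rw [hcj, inner_smul_right, b.orthonormal.2, mul_zero]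
    intro hh
    exact hij (by simp [hh])
  · rw [hσ2 j hj, inner_zero_right]

lemma exists_svd {μ ν : ℕ} (A : Matrix (Fin μ) (Fin ν) ℂ) :
    ∃ U ∈ Matrix.unitaryGroup (Fin μ) ℂ, ∃ W ∈ Matrix.unitaryGroup (Fin ν) ℂ,
      ∀ (i : Fin μ) (j : Fin ν), (i : ℕ) ≠ (j : ℕ) → (Uᴴ * A * W) i j = 0 := by
  have hH : (Aᴴ * A).IsHermitian := isHermitian_conjTranspose_mul_self A
  let W : Matrix (Fin ν) (Fin ν) ℂ := hH.eigenvectorUnitary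
  have hW : Wᴴ * W = 1 := mem_unitaryGroup_iff'.1 hH.eigenvectorUnitary.2
  have hdiag : (A * W)ᴴ * (A * W) = Matrix.diagonal (RCLike.ofReal ∘ hH.eigenvalues) := by
    have := hH.conjStarAlgAut_star_eigenvectorUnitary
    rw [Unitary.conjStarAlgAut_star_apply] at this
    rw [← this, conjTranspose_mul]
    simp only [Matrix.mul_assoc]
    rfl
  let c : Fin ν → EuclideanSpace ℂ (Fin μ) := fun j => WithLp.toLp 2 (fun i => (A * W) i j)
  obtain ⟨σ, b, hb⟩ := exists_basis c (by
    intro j k hjk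
    have := congrFun (congrFun hdiag j) k
    rw [diagonal_apply_ne _ hjk, Matrix.mul_apply] at this
    simpa [c, PiLp.inner_apply, mul_comm] using this)
  refine ⟨Matrix.of fun k i => b i k, ?_, W.submatrix id σ, ?_, ?_⟩
  · rw [mem_unitaryGroup_iff']
    ext i j
    have := orthonormal_iff_ite.1 b.orthonormal i j
    rw [PiLp.inner_apply] at this
    rw [Matrix.mul_apply, Matrix.one_apply, ← this]
    simp [Matrix.star_apply, mul_comm]
  · rw [mem_unitaryGroup_iff', star_eq_conjTranspose, conjTranspose_submatrix,
      ← submatrix_mul _ _ _ id _ Function.bijective_id, hW]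
    simp
  · intro i j hij
    rw [Matrix.mul_assoc, ← hb i j hij, Matrix.mul_apply, PiLp.inner_apply]
    refine Finset.sum_congr rfl fun k _ => ?_
    simp [c, Matrix.mul_apply, mul_comm]

lemma compactSpace_unitary (n : ℕ) : CompactSpace (Matrix.unitaryGroup (Fin n) ℂ) := by
  refine isCompact_iff_compactSpace.1 ?_
  have hcpt : IsCompact (Set.pi Set.univ fun _ : Fin n => Set.pi Set.univ fun _ : Fin n =>
      Metric.closedBall (0 : ℂ) 1) :=
    isCompact_univ_pi fun _ => isCompact_univ_pi fun _ => isCompact_closedBall _ _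
  refine IsCompact.of_isClosed_subset (X := Matrix (Fin n) (Fin n) ℂ) hcpt isClosed_unitary ?_
  intro U hU i _ j _
  simpa using entry_norm_bound_of_unitary hU i j

theorem stmt_17 (d μ ν : ℕ) (E : Set (Fin d → ℝ)) (hE : MeasurableSet E)
    (A : (Fin d → ℝ) → Matrix (Fin μ) (Fin ν) ℂ)
    (hA : ∀ i j, Measurable fun x : E => A x i j) :
    ∃ (U : (Fin d → ℝ) → Matrix (Fin μ) (Fin μ) ℂ)
      (V : (Fin d → ℝ) → Matrix (Fin ν) (Fin ν) ℂ)
      (D : (Fin d → ℝ) → Matrix (Fin μ) (Fin ν) ℂ),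
      (∀ i j, Measurable fun x : E => U x i j) ∧
      (∀ i j, Measurable fun x : E => V x i j) ∧
      (∀ i j, Measurable fun x : E => D x i j) ∧
      (∀ x ∈ E, U x ∈ Matrix.unitaryGroup (Fin μ) ℂ) ∧
      (∀ x ∈ E, V x ∈ Matrix.unitaryGroup (Fin ν) ℂ) ∧
      (∀ x ∈ E, ∀ (i : Fin μ) (j : Fin ν), (i : ℕ) ≠ (j : ℕ) → D x i j = 0) ∧
      (∀ᵐ x ∂(volume.restrict E), A x = U x * D x * V x) := by
  classical
  let K := Matrix.unitaryGroup (Fin μ) ℂ × Matrix.unitaryGroup (Fin ν) ℂ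
  have := compactSpace_unitary μ
  have := compactSpace_unitary ν
  have hmet : ∀ n : ℕ, TopologicalSpace.MetrizableSpace (Matrix (Fin n) (Fin n) ℂ) := fun n =>
    inferInstanceAs (TopologicalSpace.MetrizableSpace (Fin n → Fin n → ℂ))
  have hmet' : ∀ n : ℕ, TopologicalSpace.MetrizableSpace (Matrix.unitaryGroup (Fin n) ℂ) :=
    fun n => Topology.IsEmbedding.subtypeVal.metrizableSpace
  have : TopologicalSpace.MetrizableSpace K := inferInstanceAs (TopologicalSpace.MetrizableSpace
    (Matrix.unitaryGroup (Fin μ) ℂ × Matrix.unitaryGroup (Fin ν) ℂ))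
  let : MeasurableSpace K := borel K
  have : BorelSpace K := ⟨rfl⟩
  let G : E → K → Matrix (Fin μ) (Fin ν) ℂ := fun x k =>
    (k.1 : Matrix (Fin μ) (Fin μ) ℂ)ᴴ * A x * (k.2 : Matrix (Fin ν) (Fin ν) ℂ)
  have hGc : ∀ x, Continuous (G x) := fun x => by
    have h1 : Continuous fun k : K => (k.1 : Matrix (Fin μ) (Fin μ) ℂ) :=
      continuous_subtype_val.comp continuous_fst
    have h2 : Continuous fun k : K => (k.2 : Matrix (Fin ν) (Fin ν) ℂ) :=
      continuous_subtype_val.comp continuous_snd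
    exact (h1.matrix_conjTranspose.matrix_mul continuous_const).matrix_mul h2
  let F : E → K → ℝ := fun x k =>
    ∑ i : Fin μ, ∑ j : Fin ν, if (i : ℕ) ≠ (j : ℕ) then ‖G x k i j‖ else 0
  have hnn : ∀ x k (i : Fin μ) (j : Fin ν),
      0 ≤ if (i : ℕ) ≠ (j : ℕ) then ‖G x k i j‖ else 0 := by
    intro x k i j; split_ifs <;> positivity
  obtain ⟨s, hs, hs0⟩ := exists_meas_selection F
    (by
      intro k
      refine Finset.measurable_fun_sum _ fun i _ => Finset.measurable_fun_sum _ fun j _ => ?_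
      split_ifs
      · refine Measurable.norm ?_
        simp only [G, Matrix.mul_apply]
        exact Finset.measurable_fun_sum _ fun b _ => (Finset.measurable_fun_sum _ fun a _ =>
          (hA a b).const_mul _).mul_const _
      · exact measurable_const)
    (by
      intro x
      refine continuous_finsetSum _ fun i _ => continuous_finsetSum _ fun j _ => ?_
      split_ifs
      · exact ((hGc x).matrix_elem i j).norm
      · exact continuous_const)
    (fun x k => Finset.sum_nonneg fun i _ => Finset.sum_nonneg fun j _ => hnn x k i j)
    (by
      intro x
      obtain ⟨U, hU, W, hW, h⟩ := exists_svd (A x)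
      refine ⟨(⟨U, hU⟩, ⟨W, hW⟩), Finset.sum_eq_zero fun i _ => Finset.sum_eq_zero fun j _ => ?_⟩
      split_ifs with hij
      · simpa [G] using h i j hij
      · rfl)
  have hs1 : ∀ i j, Measurable fun x => ((s x).1 : Matrix (Fin μ) (Fin μ) ℂ) i j := fun i j =>
    (((continuous_subtype_val.comp continuous_fst : Continuous fun k : K =>
      (k.1 : Matrix (Fin μ) (Fin μ) ℂ)).matrix_elem i j).measurable).comp hs
  have hs2 : ∀ i j, Measurable fun x => ((s x).2 : Matrix (Fin ν) (Fin ν) ℂ) i j := fun i j =>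
    (((continuous_subtype_val.comp continuous_snd : Continuous fun k : K =>
      (k.2 : Matrix (Fin ν) (Fin ν) ℂ)).matrix_elem i j).measurable).comp hs
  refine ⟨fun x => if h : x ∈ E then (s ⟨x, h⟩).1 else 1,
    fun x => if h : x ∈ E then ((s ⟨x, h⟩).2 : Matrix (Fin ν) (Fin ν) ℂ)ᴴ else 1,
    fun x => if h : x ∈ E then G ⟨x, h⟩ (s ⟨x, h⟩) else 0, ?_, ?_, ?_, ?_, ?_, ?_, ?_⟩
  · intro i j
    simpa using hs1 i j
  · intro i j
    simpa [Function.comp_def] using (continuous_star (R := ℂ)).measurable.comp (hs2 j i)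
  · intro i j
    have : Measurable fun x : E => G x (s x) i j := by
      simp only [G, Matrix.mul_apply, Matrix.conjTranspose_apply]
      have h1 : ∀ i j, Measurable fun x => star (((s x).1 : Matrix (Fin μ) (Fin μ) ℂ) i j) :=
        fun i j => (continuous_star (R := ℂ)).measurable.comp (hs1 i j)
      exact Finset.measurable_fun_sum _ fun b _ => (Finset.measurable_fun_sum _ fun a _ =>
        (h1 a i).mul (hA a b)).mul (hs2 b j)
    simpa using this
  · intro x hx
    simp only [hx, dif_pos]
    exact (s ⟨x, hx⟩).1.2
  · intro x hx
    simp only [hx, dif_pos]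
    exact Unitary.star_mem (s ⟨x, hx⟩).2.2
  · intro x hx i j hij
    simp only [hx, dif_pos]
    have h := hs0 ⟨x, hx⟩
    have h1 := (Finset.sum_eq_zero_iff_of_nonneg
      (fun i _ => Finset.sum_nonneg fun j _ => hnn _ _ i j)).1 h i (Finset.mem_univ _)
    have h2 := (Finset.sum_eq_zero_iff_of_nonneg (fun j _ => hnn _ _ i j)).1 h1 j
      (Finset.mem_univ _)
    rw [if_pos hij] at h2
    exact norm_eq_zero.1 h2
  · refine (ae_restrict_iff' hE).2 (Filter.Eventually.of_forall fun x hx => ?_)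
    simp only [hx, dif_pos, G]
    have h1 := mem_unitaryGroup_iff.1 (s ⟨x, hx⟩).1.2
    have h2 := mem_unitaryGroup_iff.1 (s ⟨x, hx⟩).2.2
    rw [star_eq_conjTranspose] at h1 h2
    generalize ((s ⟨x, hx⟩).1 : Matrix (Fin μ) (Fin μ) ℂ) = P at *
    generalize ((s ⟨x, hx⟩).2 : Matrix (Fin ν) (Fin ν) ℂ) = Q at *
    rw [Matrix.mul_assoc P, Matrix.mul_assoc (Pᴴ * A x), h2, Matrix.mul_one, ← Matrix.mul_assoc,
      h1, Matrix.one_mul]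
end
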